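/- arXiv:1605.09067 — 5 statements merged into one kernel-verified Lean document; each statement's English description precedes it below -/
import Mathlib

section
/- Let g : F₂ → F₂ be an injective group homomorphism of the free group of rank 2 which is not surjective. Then there exists a natural number N ≥ 2 such that for every n ≥ N there exists an injective group homomorphism g_n : F_n → F_n (F_n the free group of rank n) such that the descending HNN extensions F₂∗_g and F_n∗_{g_n} are isomorphic as groups. -/
/-- The isomorphism `g.range ≃* ⊤` whose inverse sends `x ∈ G = ⊤` to `g x ∈ g.range`,
for an injective endomorphism `g : G →* G`. -/
noncomputable def descHNNEquiv {G : Type*} [Group G] (g : G →* G)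
    (hg : Function.Injective g) : (g.range : Subgroup G) ≃* (⊤ : Subgroup G) :=
  (MonoidHom.ofInjective hg).symm.trans Subgroup.topEquiv.symm

/-- The descending HNN extension `G∗_g` of a group `G` along an injective endomorphism
`g : G →* G`: the group `⟨G, t ∣ t⁻¹ x t = g x for all x ∈ G⟩`. -/
noncomputable def DescHNN (G : Type*) [Group G] (g : G →* G) (hg : Function.Injective g) :
    Type _ :=
  HNNExtension G g.range ⊤ (descHNNEquiv g hg)

noncomputable instance {G : Type*} [Group G] (g : G →* G) (hg : Function.Injective g) :
    Group (DescHNN G g hg) :=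
  inferInstanceAs (Group (HNNExtension G g.range ⊤ (descHNNEquiv g hg)))

/-- The canonical map `G →* G∗_g`. -/
noncomputable def DescHNN.of {G : Type*} [Group G] {g : G →* G} {hg : Function.Injective g} :
    G →* DescHNN G g hg :=
  HNNExtension.of

/-- The stable letter of `G∗_g`; it satisfies `t⁻¹ * of x * t = of (g x)`. -/
noncomputable def DescHNN.t {G : Type*} [Group G] {g : G →* G} {hg : Function.Injective g} :
    DescHNN G g hg :=
  HNNExtension.t

namespace DescHNN

theorem t_mul_of_map {G : Type*} [Group G] {g : G →* G} {hg : Function.Injective g} (x : G) :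
    (t * of (g x) : DescHNN G g hg) = of x * t := by
  have h := HNNExtension.t_mul_of (φ := descHNNEquiv g hg) ⟨g x, x, rfl⟩
  have h' : ((descHNNEquiv g hg ⟨g x, x, rfl⟩ : (⊤ : Subgroup G)) : G) = x :=
    (MonoidHom.ofInjective hg).symm_apply_apply x
  rw [h'] at h
  exact h

/-- A homomorphism out of `G∗_g`, given by its values on `G` and on the stable letter. -/
noncomputable def lift {G K : Type*} [Group G] [Group K] {g : G →* G} {hg : Function.Injective g}
    (f : G →* K) (s : K) (hs : ∀ x, s * f (g x) = f x * s) : DescHNN G g hg →* K :=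
  HNNExtension.lift f s (by
    rintro ⟨_, x, rfl⟩
    have h' : ((descHNNEquiv g hg ⟨g x, x, rfl⟩ : (⊤ : Subgroup G)) : G) = x :=
      (MonoidHom.ofInjective hg).symm_apply_apply x
    rw [h']
    exact hs x)

@[simp]
theorem lift_of {G K : Type*} [Group G] [Group K] {g : G →* G} {hg : Function.Injective g}
    (f : G →* K) (s : K) (hs : ∀ x, s * f (g x) = f x * s) (x : G) :
    lift (hg := hg) f s hs (of x) = f x :=
  HNNExtension.lift_of _ _ _ _

@[simp]
theorem lift_t {G K : Type*} [Group G] [Group K] {g : G →* G} {hg : Function.Injective g}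
    (f : G →* K) (s : K) (hs : ∀ x, s * f (g x) = f x * s) :
    lift (hg := hg) f s hs t = s :=
  HNNExtension.lift_t _ _ _

theorem hom_ext {G K : Type*} [Group G] [Group K] {g : G →* G} {hg : Function.Injective g}
    {f₁ f₂ : DescHNN G g hg →* K} (hof : ∀ x, f₁ (of x) = f₂ (of x)) (ht : f₁ t = f₂ t) :
    f₁ = f₂ :=
  HNNExtension.hom_ext (MonoidHom.ext hof) ht

/-- If `g = φ ∘ ψ` factors through `H`, then `G∗_g` is isomorphic to `H∗_{ψ ∘ φ}`. -/
noncomputable def mulEquivOfFactorization {G H : Type*} [Group G] [Group H] {g : G →* G}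
    (hg : Function.Injective g) (φ : H →* G) (ψ : G →* H) (hψφ : Function.Injective (ψ.comp φ))
    (h : ∀ x, φ (ψ x) = g x) : DescHNN G g hg ≃* DescHNN H (ψ.comp φ) hψφ :=
  MonoidHom.toMulEquiv
    (lift ((MulAut.conj t).toMonoidHom.comp (of.comp ψ)) t fun x ↦ by
      have := t_mul_of_map (hg := hψφ) (ψ x)
      simp_all [mul_assoc])
    (lift (of.comp φ) t fun x ↦ by simpa [h] using t_mul_of_map (hg := hg) (φ x))
    (hom_ext (fun x ↦ by simp [h, t_mul_of_map]) (by simp))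
    (hom_ext (fun x ↦ by
      have := t_mul_of_map (hg := hψφ) x
      simp_all) (by simp))

end DescHNN

/-- The maps `k : G × V → A` with `k (g * h, v) = k (g, h • v) * k (h, v)`, that is, the functors
from the action groupoid of `G` on `V` to `A`. -/
def IsActionCocycle {G V A : Type*} [Group G] [MulAction G V] [Group A] (k : G → V → A) : Prop :=
  ∀ g h v, k (g * h) v = k g (h • v) * k h v

theorem IsActionCocycle.map_one {G V A : Type*} [Group G] [MulAction G V] [Group A]
    {k : G → V → A} (hk : IsActionCocycle k) (v : V) : k 1 v = 1 := by
  simpa using hk 1 1 v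

theorem IsActionCocycle.map_inv {G V A : Type*} [Group G] [MulAction G V] [Group A]
    {k : G → V → A} (hk : IsActionCocycle k) (g : G) (v : V) : k g⁻¹ v = (k g (g⁻¹ • v))⁻¹ := by
  have := hk g g⁻¹ v
  rw [mul_inv_cancel, hk.map_one] at this
  exact eq_inv_of_mul_eq_one_right this.symm

namespace FreeGroup

theorem ext_of_isActionCocycle {X V A : Type*} [MulAction (FreeGroup X) V] [Group A]
    {k l : FreeGroup X → V → A} (hk : IsActionCocycle k) (hl : IsActionCocycle l)
    (h : ∀ x, k (of x) = l (of x)) : k = l := by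
  funext g
  induction g using FreeGroup.induction_on with
  | C1 => funext v; rw [hk.map_one, hl.map_one]
  | of x => exact h x
  | inv_of x hx => funext v; rw [hk.map_inv, hl.map_inv, hx]
  | mul g h hg hh => funext v; rw [hk, hl, hg, hh]

/-- An action cocycle of a free group can be prescribed arbitrarily on the generators. -/
theorem exists_isActionCocycle {X V A : Type*} [MulAction (FreeGroup X) V] [Group A]
    (c : X → V → A) :
    ∃ k : FreeGroup X → V → A, IsActionCocycle k ∧ ∀ x, k (of x) = c x := by
  let σ : X → Equiv.Perm (V × A) := fun x ↦
    { toFun := fun p ↦ (of x • p.1, c x p.1 * p.2)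
      invFun := fun p ↦ ((of x)⁻¹ • p.1, (c x ((of x)⁻¹ • p.1))⁻¹ * p.2)
      left_inv := fun p ↦ by simp
      right_inv := fun p ↦ by simp }
  have key : ∀ g v a, lift σ g (v, a) = (g • v, (lift σ g (v, 1)).2 * a) := by
    intro g
    induction g using FreeGroup.induction_on with
    | C1 => simp
    | of x => simp [σ]
    | inv_of x hx =>
      intro v a
      rw [_root_.map_inv, lift_apply_of]
      exact Prod.ext rfl (by simp [σ, Equiv.Perm.inv_def, Equiv.symm])
    | mul g h hg hh =>
      intro v a
      rw [_root_.map_mul, Equiv.Perm.mul_apply, Equiv.Perm.mul_apply, hh v a, hh v 1, hg,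
        hg _ (_ * 1), mul_smul]
      simp [mul_assoc]
  refine ⟨fun g v ↦ (lift σ g (v, 1)).2, fun g h v ↦ ?_, fun x ↦ ?_⟩
  · dsimp only
    rw [_root_.map_mul, Equiv.Perm.mul_apply, key h v 1, key g _ (_ * 1)]
  · funext v
    simp [σ]

theorem bijective_isActionCocycle_restrict_of (X V A : Type*) [MulAction (FreeGroup X) V]
    [Group A] : Function.Bijective
      (fun (k : {k : FreeGroup X → V → A // IsActionCocycle k}) (x : X) ↦ k.1 (of x)) := by
  refine ⟨fun k l h ↦ Subtype.ext (ext_of_isActionCocycle k.2 l.2 (congr_fun h)), fun c ↦ ?_⟩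
  obtain ⟨k, hk, hc⟩ := exists_isActionCocycle c
  exact ⟨⟨k, hk⟩, funext hc⟩

end FreeGroup

/-- The restriction of an action cocycle to the stabilizer of a point. -/
def IsActionCocycle.toHom {G V A : Type*} [Group G] [MulAction G V] [Group A]
    {k : G → V → A} (hk : IsActionCocycle k) (r : V) : MulAction.stabilizer G r →* A where
  toFun h := k h r
  map_one' := hk.map_one r
  map_mul' g h := by
    have : (h : G) • r = r := h.2
    simpa [this] using hk g h r

/-- If `τ` picks for every `v` a group element taking `r` to `v`, with `τ r = 1`, then an action
cocycle is determined by its restriction to the stabilizer of `r` and its values at `(τ v, r)` for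
`v ≠ r`, and these data can be prescribed arbitrarily. -/
theorem IsActionCocycle.bijective_toHom {G V : Type*} (A : Type*) [Group G] [MulAction G V]
    [Group A] (r : V) (τ : V → G) (hτ : ∀ v, τ v • r = v) (hr : τ r = 1) :
    Function.Bijective (fun k : {k : G → V → A // IsActionCocycle k} ↦
      (k.2.toHom r, fun v : {v : V // v ≠ r} ↦ k.1 (τ v) r)) := by
  classical
  have hmem : ∀ g v, (τ (g • v))⁻¹ * g * τ v ∈ MulAction.stabilizer G r := fun g v ↦ by
    rw [MulAction.mem_stabilizer_iff, mul_smul, mul_smul, hτ, inv_smul_eq_iff, hτ]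
  constructor
  · rintro ⟨k, hk⟩ ⟨l, hl⟩ h
    simp only [Prod.mk.injEq] at h
    obtain ⟨h₁, h₂⟩ := h
    have h₃ : ∀ v, k (τ v) r = l (τ v) r := fun v ↦ by
      by_cases hv : v = r
      · rw [hv, hr, hk.map_one, hl.map_one]
      · exact congr_fun h₂ ⟨v, hv⟩
    have h₄ : ∀ h ∈ MulAction.stabilizer G r, k h r = l h r := fun h hh ↦
      DFunLike.congr_fun h₁ ⟨h, hh⟩
    have formula : ∀ {k : G → V → A}, IsActionCocycle k → ∀ g v, k g v =
        k (τ (g • v)) r * k ((τ (g • v))⁻¹ * g * τ v) r * (k (τ v) r)⁻¹ := by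
      intro k hk g v
      have e₁ := hk g (τ v) r
      have e₂ := hk (τ (g • v)) ((τ (g • v))⁻¹ * g * τ v) r
      rw [hmem g v] at e₂
      rw [← e₂, eq_mul_inv_iff_mul_eq, ← mul_assoc, mul_inv_cancel_left, e₁, hτ]
    ext g v
    change k g v = l g v
    rw [formula hk, formula hl, h₃, h₃, h₄ _ (hmem g v)]
  · rintro ⟨φ, f⟩
    let F : V → A := fun v ↦ if h : v = r then 1 else f ⟨v, h⟩
    have hF : F r = 1 := dif_pos rfl
    let k : G → V → A := fun g v ↦ F (g • v) * φ ⟨_, hmem g v⟩ * (F v)⁻¹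
    have hk : IsActionCocycle k := by
      intro g h v
      have : (⟨_, hmem (g * h) v⟩ : MulAction.stabilizer G r) =
          ⟨_, hmem g (h • v)⟩ * ⟨_, hmem h v⟩ := by
        ext
        simp [mul_smul, mul_assoc]
      simp only [k, this, map_mul]
      simp [mul_smul, mul_assoc]
    refine ⟨⟨k, hk⟩, Prod.ext ?_ ?_⟩
    · ext ⟨h, hh⟩
      have hh' : h • r = r := hh
      have : (⟨_, hmem h r⟩ : MulAction.stabilizer G r) = ⟨h, hh⟩ := by
        ext
        simp [hh', hr]
      change F (h • r) * φ ⟨_, hmem h r⟩ * (F r)⁻¹ = φ ⟨h, hh⟩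
      rw [this, hh', hF]
      simp
    · funext v
      have : (⟨_, hmem (τ v) r⟩ : MulAction.stabilizer G r) = 1 := by
        ext
        simp [hτ, hr]
      change F (τ v • r) * φ ⟨_, hmem (τ v) r⟩ * (F r)⁻¹ = f v
      rw [this, hτ, hF]
      simp [F, v.2]

/-- **Schreier's index formula**: a subgroup of index `m` in a free group of rank `n` is free of
rank `m * (n - 1) + 1`. -/
theorem FreeGroup.card_generators_add_index {X : Type*} [Finite X] (H : Subgroup (FreeGroup X))
    (hH : H.index ≠ 0) :
    Finite (IsFreeGroup.Generators H) ∧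
      Nat.card (IsFreeGroup.Generators H) + H.index = Nat.card X * H.index + 1 := by
  classical
  let V := FreeGroup X ⧸ H
  let r : V := ((1 : FreeGroup X) : V)
  let A := Multiplicative (ZMod 2)
  have hA : Nat.card A = 2 := by simp [A]
  have : Nontrivial A := inferInstanceAs (Nontrivial (Multiplicative (ZMod 2)))
  have : Finite A := inferInstanceAs (Finite (Multiplicative (ZMod 2)))
  have : Finite V := Nat.finite_of_card_ne_zero hH
  have hV : Nat.card V = H.index := rfl
  let τ : V → FreeGroup X := Function.update Quotient.out r 1
  have hτ : ∀ v, τ v • r = v := fun v ↦ by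
    by_cases h : v = r
    · simp [τ, h]
    · rw [show τ v = v.out from Function.update_of_ne h _ _, MulAction.Quotient.smul_coe,
        smul_eq_mul, mul_one]
      exact QuotientGroup.out_eq' v
  have hr : τ r = 1 := by simp [τ]
  have hstab : MulAction.stabilizer (FreeGroup X) r = H := MulAction.stabilizer_quotient H
  let e₁ := Equiv.ofBijective _ (FreeGroup.bijective_isActionCocycle_restrict_of X V A)
  let e₂ := Equiv.ofBijective _ (IsActionCocycle.bijective_toHom A r τ hτ hr)
  let e₃ : (MulAction.stabilizer (FreeGroup X) r →* A) ≃ (IsFreeGroup.Generators H → A) :=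
    (MulEquiv.subgroupCongr hstab).monoidHomCongrLeftEquiv.trans IsFreeGroup.lift.symm
  let e := (e₁.symm.trans e₂).trans (e₃.prodCongr (Equiv.refl _))
  have hfin : Finite ((IsFreeGroup.Generators H → A) × ({v : V // v ≠ r} → A)) :=
    Finite.of_equiv _ e
  have hfin' : Finite (IsFreeGroup.Generators H) := by
    have : Finite (IsFreeGroup.Generators H → A) :=
      Finite.of_surjective (Prod.fst : _ × ({v : V // v ≠ r} → A) → _) Prod.fst_surjective
    by_contra h
    rw [not_finite_iff_infinite] at h
    exact not_finite (IsFreeGroup.Generators H → A)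
  refine ⟨hfin', ?_⟩
  have hcard := Nat.card_congr e
  have hne : Nat.card {v : V // v ≠ r} + 1 = H.index := by
    rw [← hV, ← Nat.card_congr (Equiv.optionSubtypeNe r), Finite.card_option]
  rw [Nat.card_prod, Nat.card_fun, Nat.card_fun, Nat.card_fun, Nat.card_fun, hA, hV, ← pow_mul,
    ← pow_add] at hcard
  have := Nat.pow_right_injective le_rfl hcard
  rw [mul_comm] at this
  omega

namespace FreeGroup

variable {X Ω : Type*} [MulAction (FreeGroup X) Ω]

/-- The path traced by the word `L`, acting on `p` letter by letter starting with the last letter,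
stays in `V`. -/
def StaysIn (V : Finset Ω) (p : Ω) (L : List (X × Bool)) : Prop :=
  ∀ s, s <:+ L → mk s • p ∈ V

theorem StaysIn.of_cons {V : Finset Ω} {p : Ω} {a : X × Bool} {L : List (X × Bool)}
    (h : StaysIn V p (a :: L)) : StaysIn V p L :=
  fun s hs ↦ h s (hs.trans (List.suffix_cons a L))

theorem StaysIn.cons {V : Finset Ω} {p : Ω} {a : X × Bool} {L : List (X × Bool)}
    (h : StaysIn V p L) (ha : mk (a :: L) • p ∈ V) : StaysIn V p (a :: L) := by
  intro s hs
  rcases List.suffix_cons_iff.mp hs with rfl | hs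
  · exact ha
  · exact h s hs

theorem StaysIn.mono {V W : Finset Ω} (hVW : V ⊆ W) {p : Ω} {L : List (X × Bool)}
    (h : StaysIn V p L) : StaysIn W p L :=
  fun s hs ↦ hVW (h s hs)

theorem StaysIn.smul_mem {V : Finset Ω} {p : Ω} {L : List (X × Bool)}
    (h : StaysIn V p L) : mk L • p ∈ V :=
  h L (List.suffix_refl L)

/-- The partial injection `v ↦ g • v` of a finite set `V` extends to a permutation of `V`. -/
theorem exists_perm_extending_smul {G : Type*} [Group G] [MulAction G Ω] (V : Finset Ω) (g : G) :
    ∃ σ : Equiv.Perm V, ∀ v w : V, g • (v : Ω) = w → σ v = w := by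
  classical
  let e : {v : V // g • (v : Ω) ∈ V} ≃ {w : V // g⁻¹ • (w : Ω) ∈ V} :=
    { toFun := fun v ↦ ⟨⟨g • (v : Ω), v.2⟩, by simp⟩
      invFun := fun w ↦ ⟨⟨g⁻¹ • (w : Ω), w.2⟩, by simp⟩
      left_inv := fun v ↦ by simp
      right_inv := fun w ↦ by simp }
  refine ⟨e.extendSubtype, fun v w h ↦ ?_⟩
  have hv : g • (v : Ω) ∈ V := h ▸ w.2
  exact (e.extendSubtype_apply_of_mem v hv).trans (Subtype.ext h)

/-- A finite set of vertices of the action graph carries a permutation action of the free group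
which agrees with the original one along all paths that stay in the set. -/
theorem exists_hom_perm_agreeing (V : Finset Ω) : ∃ ρ : FreeGroup X →* Equiv.Perm V,
    ∀ (p : V) (L : List (X × Bool)), StaysIn V (p : Ω) L → (ρ (mk L) p : Ω) = mk L • (p : Ω) := by
  choose σ hσ using fun x : X ↦ exists_perm_extending_smul V (of x)
  refine ⟨lift σ, fun p L ↦ ?_⟩
  induction L with
  | nil => intro _; simp [← one_eq_mk]
  | cons a L ih =>
    intro h
    obtain ⟨x, b⟩ := a
    have ih := ih h.of_cons
    have hmem := h.smul_mem
    have hL : mk L • (p : Ω) ∈ V := h.of_cons.smul_mem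
    have ih' : lift σ (mk L) p = ⟨_, hL⟩ := Subtype.ext ih
    cases b with
    | true =>
      have hcons : mk ((x, true) :: L) = of x * mk L := rfl
      rw [hcons, mul_smul] at hmem ⊢
      rw [_root_.map_mul, Equiv.Perm.mul_apply, ih', lift_apply_of, hσ x _ ⟨_, hmem⟩ rfl]
    | false =>
      have hcons : mk ((x, false) :: L) = (of x)⁻¹ * mk L := rfl
      rw [hcons, mul_smul] at hmem ⊢
      rw [_root_.map_mul, Equiv.Perm.mul_apply, ih', _root_.map_inv, lift_apply_of,
        Equiv.Perm.inv_eq_iff_eq.mpr (hσ x ⟨_, hmem⟩ ⟨_, hL⟩ (smul_inv_smul _ _)).symm]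

/-- Every vertex of `V` is joined to `p` by a path that stays in `V`. -/
def IsConnectedFrom (X : Type*) {Ω : Type*} [MulAction (FreeGroup X) Ω] (V : Finset Ω)
    (p : Ω) : Prop :=
  ∀ v ∈ V, ∃ L : List (X × Bool), StaysIn V p L ∧ mk L • p = v

open Classical in
theorem IsConnectedFrom.exists_insert [Infinite Ω] [MulAction.IsPretransitive (FreeGroup X) Ω]
    {V : Finset Ω} {p : Ω} (hp : p ∈ V) (hV : IsConnectedFrom X V p) :
    ∃ w ∉ V, IsConnectedFrom X (insert w V) p := by
  obtain ⟨a, v, hv, hav⟩ : ∃ a : X × Bool, ∃ v ∈ V, mk [a] • v ∉ V := by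
    by_contra! h
    have hinv : ∀ L : List (X × Bool), mk L • p ∈ V := by
      intro L
      induction L with
      | nil => simpa [← one_eq_mk]
      | cons a L ih =>
        have := h a _ ih
        rwa [← mul_smul] at this
    obtain ⟨w, hw⟩ := Infinite.exists_notMem_finset V
    obtain ⟨g, rfl⟩ := MulAction.exists_smul_eq (FreeGroup X) p w
    exact hw (by simpa [mk_toWord] using hinv g.toWord)
  have hsub := Finset.subset_insert (mk [a] • v) V
  refine ⟨mk [a] • v, hav, fun w hw ↦ ?_⟩
  rcases Finset.mem_insert.mp hw with rfl | hw
  · obtain ⟨L, hL, rfl⟩ := hV v hv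
    have h : mk (a :: L) • p = mk [a] • mk L • p := by rw [← mul_smul]; rfl
    exact ⟨a :: L, (hL.mono hsub).cons (h ▸ Finset.mem_insert_self _ _), h⟩
  · obtain ⟨L, hL, hw⟩ := hV w hw
    exact ⟨L, hL.mono hsub, hw⟩

/-- In an infinite transitive action graph, a finite connected set of vertices can be enlarged to
a connected set of any larger finite size. -/
theorem IsConnectedFrom.exists_superset_card [Infinite Ω]
    [MulAction.IsPretransitive (FreeGroup X) Ω] {V : Finset Ω} {p : Ω} (hp : p ∈ V)
    (hV : IsConnectedFrom X V p) {m : ℕ} (hm : V.card ≤ m) :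
    ∃ W, V ⊆ W ∧ IsConnectedFrom X W p ∧ W.card = m := by
  classical
  induction m, hm using Nat.le_induction with
  | base => exact ⟨V, subset_rfl, hV, rfl⟩
  | succ m _ ih =>
    obtain ⟨W, hVW, hW, hc⟩ := ih
    obtain ⟨w, hw, hW'⟩ := hW.exists_insert (hVW hp)
    exact ⟨insert w W, hVW.trans (Finset.subset_insert _ _), hW', by
      rw [Finset.card_insert_of_notMem hw, hc]⟩

theorem exists_isConnectedFrom_staysIn (p : Ω) (S : Finset (List (X × Bool))) :
    ∃ V : Finset Ω, p ∈ V ∧ IsConnectedFrom X V p ∧ ∀ L ∈ S, StaysIn V p L := by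
  classical
  let T := insert [] (S.biUnion fun L ↦ L.tails.toFinset)
  have hT : ∀ L ∈ T, ∀ s, s <:+ L → s ∈ T := by
    intro L hL s hs
    simp only [T, Finset.mem_insert, Finset.mem_biUnion, List.mem_toFinset,
      List.mem_tails] at hL ⊢
    rcases hL with rfl | ⟨M, hM, hLM⟩
    · exact Or.inl (List.suffix_nil.mp hs)
    · exact Or.inr ⟨M, hM, hs.trans hLM⟩
  have hstay : ∀ L ∈ T, StaysIn (T.image fun L ↦ mk L • p) p L := fun L hL s hs ↦
    Finset.mem_image_of_mem (fun L ↦ mk L • p) (hT L hL s hs)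
  refine ⟨T.image fun L ↦ mk L • p, ?_, fun v hv ↦ ?_, fun L hL ↦ hstay L ?_⟩
  · exact Finset.mem_image.mpr ⟨[], by simp [T], by simp [← one_eq_mk]⟩
  · obtain ⟨L, hL, rfl⟩ := Finset.mem_image.mp hv
    exact ⟨L, hstay L hL, rfl⟩
  · simp only [T, Finset.mem_insert, Finset.mem_biUnion, List.mem_toFinset, List.mem_tails]
    exact Or.inr ⟨L, hL, List.suffix_refl L⟩

/-- A finitely generated subgroup of infinite index in a free group is contained in subgroups of
every sufficiently large finite index. -/
theorem exists_le_index_eq_of_fg {K : Subgroup (FreeGroup X)} (hK : K.FG) (hi : K.index = 0) :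
    ∃ M : ℕ, ∀ m, M ≤ m → ∃ H : Subgroup (FreeGroup X), K ≤ H ∧ H.index = m := by
  classical
  obtain ⟨S, rfl⟩ := hK
  set K := Subgroup.closure (S : Set (FreeGroup X))
  have : Infinite (FreeGroup X ⧸ K) := Subgroup.index_eq_zero_iff_infinite.mp hi
  let p : FreeGroup X ⧸ K := ((1 : FreeGroup X) : FreeGroup X ⧸ K)
  obtain ⟨V, hpV, hV, hS⟩ := exists_isConnectedFrom_staysIn p (S.image toWord)
  refine ⟨V.card, fun m hm ↦ ?_⟩
  obtain ⟨W, hVW, hW, rfl⟩ := hV.exists_superset_card hpV hm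
  obtain ⟨ρ, hρ⟩ := exists_hom_perm_agreeing (X := X) W
  let q : W := ⟨p, hVW hpV⟩
  let : MulAction (FreeGroup X) W := MulAction.compHom W ρ
  have hsmul : ∀ (g : FreeGroup X) (w : W), g • w = ρ g w := fun _ _ ↦ rfl
  have htrans : MulAction.IsPretransitive (FreeGroup X) W := by
    refine (MulAction.isPretransitive_iff_base q).mpr fun w ↦ ?_
    obtain ⟨L, hL, hw⟩ := hW w w.2
    exact ⟨mk L, Subtype.ext ((hρ q L hL).trans hw)⟩
  refine ⟨MulAction.stabilizer (FreeGroup X) q, (Subgroup.closure_le _).mpr fun g hg ↦ ?_, ?_⟩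
  · have h := hρ q g.toWord ((hS _ (Finset.mem_image_of_mem _ hg)).mono hVW)
    have hgp : g • p = p := by
      have : g ∈ MulAction.stabilizer (FreeGroup X) p := by
        rw [MulAction.stabilizer_quotient]
        exact Subgroup.subset_closure hg
      exact this
    rw [mk_toWord] at h
    exact Subtype.ext (h.trans hgp)
  · rw [MulAction.index_stabilizer_of_transitive]
    simp

end FreeGroup

theorem FreeGroup.index_range_eq_zero_of_not_surjective
    {g : FreeGroup (Fin 2) →* FreeGroup (Fin 2)} (hg : Function.Injective g)
    (hns : ¬ Function.Surjective g) : g.range.index = 0 := by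
  by_contra h
  obtain ⟨-, hcard⟩ := FreeGroup.card_generators_add_index g.range h
  have e : FreeGroup (Fin 2) ≃* FreeGroup (IsFreeGroup.Generators g.range) :=
    (MonoidHom.ofInjective hg).trans (IsFreeGroup.toFreeGroup _)
  rw [← Nat.card_congr (Equiv.ofFreeGroupEquiv e), Nat.card_fin] at hcard
  exact hns (MonoidHom.range_eq_top.mp (Subgroup.index_eq_one.mp (by omega)))

/-- If `g : F₂ → F₂` is an injective, non-surjective endomorphism of the
free group of rank 2, then there is an `N ≥ 2` such that for every `n ≥ N` there is an
injective endomorphism `gₙ : Fₙ → Fₙ` with `F₂∗_g ≅ Fₙ∗_{gₙ}`. -/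
theorem descHNN_F2_eq_descHNN_Fn
    (g : FreeGroup (Fin 2) →* FreeGroup (Fin 2)) (hg : Function.Injective g)
    (hns : ¬ Function.Surjective g) :
    ∃ N : ℕ, 2 ≤ N ∧ ∀ n : ℕ, N ≤ n →
      ∃ (gn : FreeGroup (Fin n) →* FreeGroup (Fin n)) (hgn : Function.Injective gn),
        Nonempty (DescHNN (FreeGroup (Fin 2)) g hg ≃* DescHNN (FreeGroup (Fin n)) gn hgn) := by
  have hfg : g.range.FG := (Group.fg_iff_subgroup_fg _).mp inferInstance
  obtain ⟨M, hM⟩ := FreeGroup.exists_le_index_eq_of_fg hfg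
    (FreeGroup.index_range_eq_zero_of_not_surjective hg hns)
  refine ⟨M + 2, by omega, fun n hn ↦ ?_⟩
  obtain ⟨H, hgH, hH⟩ := hM (n - 1) (by omega)
  obtain ⟨_, hcard⟩ := FreeGroup.card_generators_add_index H (by omega)
  have hn' : Nat.card (IsFreeGroup.Generators H) = n := by
    rw [hH, Nat.card_fin] at hcard
    omega
  let e : FreeGroup (Fin n) ≃* H :=
    (FreeGroup.freeGroupCongr (Finite.equivFinOfCardEq hn').symm).trans
      (IsFreeGroup.toFreeGroup H).symm
  let φ : FreeGroup (Fin n) →* FreeGroup (Fin 2) := H.subtype.comp e.toMonoidHom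
  let ψ : FreeGroup (Fin 2) →* FreeGroup (Fin n) :=
    e.symm.toMonoidHom.comp (g.codRestrict H fun x ↦ hgH ⟨x, rfl⟩)
  have hφψ : ∀ x, φ (ψ x) = g x := fun x ↦ by simp [φ, ψ]
  have hψ : Function.Injective ψ := fun x y h ↦ hg (by rw [← hφψ, ← hφψ, h])
  have hφ : Function.Injective φ := Subtype.val_injective.comp e.injective
  exact ⟨ψ.comp φ, hψ.comp hφ, ⟨DescHNN.mulEquivOfFactorization hg φ ψ (hψ.comp hφ) hφψ⟩⟩
end

section
/- Let g : F_n → F_n be an injective group homomorphism of the free group of rank n. Then the descending HNN extension G = F_n∗_g is locally indicable, i.e., every nontrivial finitely generated subgroup of G admits a surjective group homomorphism onto ℤ. -/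
theorem MonoidHom.exists_surjective_multiplicative_int {H : Type*} [Group H]
    (f : H →* Multiplicative ℤ) {x : H} (hx : f x ≠ 1) :
    ∃ f : H →* Multiplicative ℤ, Function.Surjective f := by
  have : Nontrivial f.range :=
    ⟨⟨⟨f x, x, rfl⟩, 1, fun h => hx (congrArg Subtype.val h)⟩⟩
  have : Infinite f.range := by
    refine Infinite.of_injective
      (fun k : ℤ => (⟨f x, x, rfl⟩ : f.range) ^ k) fun a b hab => ?_
    have h := congrArg (fun y : f.range => Multiplicative.toAdd (y : Multiplicative ℤ)) hab
    have hx' : Multiplicative.toAdd (f x) ≠ 0 := fun h0 => hx (toAdd_eq_zero.mp h0)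
    simpa [hx'] using h
  exact ⟨(intCyclicMulEquiv (G := f.range)).symm.toMonoidHom.comp f.rangeRestrict,
    (intCyclicMulEquiv (G := f.range)).symm.surjective.comp f.rangeRestrict_surjective⟩

theorem IsFreeGroup.exists_surjective_multiplicative_int (H : Type*) [Group H] [IsFreeGroup H]
    [Nontrivial H] : ∃ f : H →* Multiplicative ℤ, Function.Surjective f := by
  rcases isEmpty_or_nonempty (IsFreeGroup.Generators H) with he | ⟨⟨i⟩⟩
  · have := (IsFreeGroup.toFreeGroup H).toEquiv.subsingleton
    exact (not_subsingleton H this).elim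
  · let f : H →* Multiplicative ℤ := (IsFreeGroup.basis H).lift fun _ => Multiplicative.ofAdd 1
    refine f.exists_surjective_multiplicative_int (x := IsFreeGroup.basis H i) ?_
    simp [f]

namespace DescHNN

variable {G : Type*} [Group G] {g : G →* G} {hg : Function.Injective g}

theorem of_injective : Function.Injective (of : G →* DescHNN G g hg) :=
  HNNExtension.of_injective _

theorem of_mul_t (x : G) : (of x * t : DescHNN G g hg) = t * of (g x) := by
  have h := HNNExtension.t_mul_of (φ := descHNNEquiv g hg) ⟨g x, x, rfl⟩
  have hx : ((descHNNEquiv g hg ⟨g x, x, rfl⟩ : (⊤ : Subgroup G)) : G) = x :=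
    (MonoidHom.ofInjective hg).symm_apply_apply x
  rw [hx] at h
  exact h.symm

theorem of_mul_t_pow (x : G) (n : ℕ) :
    (of x * t ^ n : DescHNN G g hg) = t ^ n * of (g^[n] x) := by
  induction n with
  | zero => simp
  | succ n ih =>
    rw [pow_succ, ← mul_assoc, ih, mul_assoc, of_mul_t, ← mul_assoc,
      Function.iterate_succ_apply']

/-- The exponent sum of the stable letter. -/
noncomputable def height : DescHNN G g hg →* Multiplicative ℤ :=
  HNNExtension.lift 1 (Multiplicative.ofAdd 1) (by simp)

@[simp]
theorem height_of (x : G) : height (of x : DescHNN G g hg) = 1 :=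
  HNNExtension.lift_of _ _ _ _

@[simp]
theorem height_t : height (t : DescHNN G g hg) = Multiplicative.ofAdd 1 :=
  HNNExtension.lift_t _ _ _

theorem of_eq_conj (x : G) (m : ℕ) :
    (of x : DescHNN G g hg) = t ^ m * of (g^[m] x) * (t ^ m)⁻¹ := by
  rw [← of_mul_t_pow, mul_inv_cancel_right]

@[elab_as_elim]
theorem induction_on {motive : DescHNN G g hg → Prop} (w : DescHNN G g hg)
    (of : ∀ x, motive (of x)) (t : motive t)
    (mul : ∀ v w, motive v → motive w → motive (v * w))
    (inv : ∀ w, motive w → motive w⁻¹) : motive w :=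
  HNNExtension.induction_on w of t mul inv

theorem exists_eq_pow_mul_of_mul_pow_inv (w : DescHNN G g hg) :
    ∃ (k l : ℕ) (x : G), w = t ^ k * of x * (t ^ l)⁻¹ := by
  induction w using DescHNN.induction_on with
  | of x => exact ⟨0, 0, x, by simp⟩
  | t => exact ⟨1, 0, 1, by simp⟩
  | mul v w hv hw =>
    obtain ⟨k, l, x, rfl⟩ := hv
    obtain ⟨k', l', y, rfl⟩ := hw
    refine ⟨k + k', l' + l, g^[k'] x * g^[l] y, ?_⟩
    have hc : (t : DescHNN G g hg) ^ l * t ^ k' = t ^ k' * t ^ l := pow_mul_comm _ _ _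
    have hc' : ((t : DescHNN G g hg) ^ k')⁻¹ * (t ^ l)⁻¹ * t ^ k' * t ^ l = 1 := by
      rw [← mul_inv_rev, hc, mul_assoc, ← hc, inv_mul_cancel]
    rw [of_eq_conj x k', of_eq_conj y l, pow_add, pow_add, map_mul]
    calc _ = t ^ k * (t ^ k' * of (g^[k'] x)) * ((t ^ k')⁻¹ * (t ^ l)⁻¹ * t ^ k' * t ^ l) *
          (of (g^[l] y) * (t ^ l)⁻¹ * (t ^ l')⁻¹) := by simp only [mul_assoc]
      _ = _ := by rw [hc']; simp only [mul_assoc, mul_one, mul_inv_rev]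
  | inv w hw =>
    obtain ⟨k, l, x, rfl⟩ := hw
    refine ⟨l, k, x⁻¹, ?_⟩
    simp [mul_assoc]

/-- The embedding of the base group as the conjugate of its canonical image by `t ^ k`. -/
noncomputable def conjOf (k : ℕ) : G →* DescHNN G g hg :=
  (MulAut.conj (t ^ k)).toMonoidHom.comp of

theorem conjOf_apply (k : ℕ) (x : G) :
    (conjOf k x : DescHNN G g hg) = t ^ k * of x * (t ^ k)⁻¹ :=
  rfl

theorem conjOf_injective (k : ℕ) : Function.Injective (conjOf k : G →* DescHNN G g hg) :=
  (MulAut.conj (t ^ k)).injective.comp of_injective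

theorem range_conjOf_mono :
    Monotone fun k => (conjOf k : G →* DescHNN G g hg).range := by
  rintro k _ h _ ⟨x, rfl⟩
  obtain ⟨m, rfl⟩ := exists_add_of_le h
  refine ⟨g^[m] x, ?_⟩
  rw [conjOf_apply, conjOf_apply, of_eq_conj x m, pow_add]
  simp only [mul_assoc, mul_inv_rev]

theorem exists_mem_range_conjOf {w : DescHNN G g hg} (hw : height w = 1) :
    ∃ k, w ∈ (conjOf k : G →* DescHNN G g hg).range := by
  obtain ⟨k, l, x, rfl⟩ := exists_eq_pow_mul_of_mul_pow_inv w
  have h : k = l := by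
    simpa [mul_inv_eq_one, ← ofAdd_nsmul] using hw
  subst h
  exact ⟨k, x, rfl⟩

theorem exists_le_range_conjOf {H : Subgroup (DescHNN G g hg)} (hH : H.FG)
    (h : ∀ w ∈ H, height w = 1) : ∃ k, H ≤ (conjOf k : G →* DescHNN G g hg).range := by
  obtain ⟨S, rfl⟩ := hH
  choose! k hk using fun w (hw : w ∈ S) =>
    exists_mem_range_conjOf (h w (Subgroup.subset_closure hw))
  exact ⟨S.sup k, (Subgroup.closure_le _).mpr fun w hw =>
    range_conjOf_mono (Finset.le_sup hw) (hk w hw)⟩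

end DescHNN

/-- The descending HNN extension `G = Fₙ∗_g` of a finitely generated free
group along an injective endomorphism is locally indicable: every nontrivial finitely
generated subgroup of `G` surjects onto `ℤ`. -/
theorem descHNN_locallyIndicable {n : ℕ}
    (g : FreeGroup (Fin n) →* FreeGroup (Fin n)) (hg : Function.Injective g) :
    ∀ H : Subgroup (DescHNN (FreeGroup (Fin n)) g hg), H.FG → H ≠ ⊥ →
      ∃ f : H →* Multiplicative ℤ, Function.Surjective f := by
  intro H hH hne
  by_cases h : ∀ w ∈ H, DescHNN.height w = 1
  · obtain ⟨k, hk⟩ := DescHNN.exists_le_range_conjOf hH h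
    have : Nontrivial H := (Subgroup.nontrivial_iff_ne_bot H).mpr hne
    have : IsFreeGroup (DescHNN.conjOf (hg := hg) k).range :=
      IsFreeGroup.ofMulEquiv (MonoidHom.ofInjective (DescHNN.conjOf_injective k))
    have : IsFreeGroup H := IsFreeGroup.ofMulEquiv (Subgroup.subgroupOfEquivOfLe hk)
    exact IsFreeGroup.exists_surjective_multiplicative_int H
  · push Not at h
    obtain ⟨w, hw, hw1⟩ := h
    exact (DescHNN.height.comp H.subtype).exists_surjective_multiplicative_int (x := ⟨w, hw⟩) hw1
end

section
/- Let G be a group and let N be a normal subgroup of G such that the quotient group G/N is free abelian and N is locally indicable. Then G is locally indicable. -/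
universe u

/-- A nontrivial homomorphism to `ℤ` yields a surjective one: its range is infinite cyclic. -/
theorem exists_surjective_of_apply_ne_one {H : Type*} [Group H] (f : H →* Multiplicative ℤ)
    {h : H} (hf : f h ≠ 1) : ∃ g : H →* Multiplicative ℤ, Function.Surjective g := by
  have hne : (⟨f h, h, rfl⟩ : f.range) ≠ 1 := fun e => hf (congrArg Subtype.val e)
  have : Infinite f.range :=
    Infinite.of_injective _ <| injective_zpow_iff_not_isOfFinOrder.mpr <|
      not_isOfFinOrder_of_isMulTorsionFree hne
  let e : f.range ≃* Multiplicative ℤ := mulEquivOfCyclicCardEq (by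
    rw [Nat.card_eq_zero_of_infinite, Nat.card_eq_zero_of_infinite])
  exact ⟨e.toMonoidHom.comp f.rangeRestrict, e.surjective.comp f.rangeRestrict_surjective⟩

/-- If `N` is a normal subgroup of `G` such that `G/N` is free abelian and
`N` is locally indicable (every nontrivial finitely generated subgroup surjects onto `ℤ`),
then `G` is locally indicable. -/
theorem locallyIndicable_of_quotient_freeAbelian {G : Type u} [Group G]
    (N : Subgroup G) [N.Normal]
    (hfree : ∃ ι : Type u, Nonempty ((G ⧸ N) ≃* Multiplicative (FreeAbelianGroup ι)))
    (hN : ∀ H : Subgroup N, H.FG → H ≠ ⊥ →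
      ∃ f : H →* Multiplicative ℤ, Function.Surjective f) :
    ∀ H : Subgroup G, H.FG → H ≠ ⊥ →
      ∃ f : H →* Multiplicative ℤ, Function.Surjective f := by
  intro H hfg hbot
  by_cases hle : H ≤ N
  · let e := Subgroup.subgroupOfEquivOfLe hle
    have hfg' : (H.subgroupOf N).FG := by
      rw [← Group.fg_iff_subgroup_fg] at hfg ⊢
      exact Group.fg_of_surjective (f := e.symm.toMonoidHom) e.symm.surjective
    obtain ⟨f, hf⟩ := hN (H.subgroupOf N) hfg' fun h =>
      hbot ((Subgroup.subgroupOf_eq_bot.mp h).eq_bot_of_le hle)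
    exact ⟨f.comp e.symm.toMonoidHom, hf.comp e.symm.surjective⟩
  · obtain ⟨h, hH, hhN⟩ := SetLike.not_le_iff_exists.mp hle
    obtain ⟨ι, ⟨e⟩⟩ := hfree
    have hne : FreeAbelianGroup.equivFinsupp ι (e (h : G ⧸ N)).toAdd ≠ 0 := by
      rw [ne_eq, EmbeddingLike.map_eq_zero_iff, toAdd_eq_zero, EmbeddingLike.map_eq_one_iff,
        QuotientGroup.eq_one_iff]
      exact hhN
    obtain ⟨i, hi⟩ := Finsupp.ne_iff.mp hne
    exact exists_surjective_of_apply_ne_one (h := (⟨h, hH⟩ : H))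
      (((FreeAbelianGroup.coeff i).toMultiplicative.comp e.toMonoidHom).comp
        ((QuotientGroup.mk' N).comp H.subtype)) hi
end

section
/- Minkowski summation of polytopes is cancellative: if A, B, C are nonempty finite subsets of ℝ^d and convexHull(A) + convexHull(C) = convexHull(B) + convexHull(C) (Minkowski sums of sets), then convexHull(A) = convexHull(B). -/
open Pointwise

/-- **Rådström's cancellation law**: a nonempty compact summand can be cancelled from an inclusion
of Minkowski sums whose other right-hand summand is closed and convex. -/
theorem Convex.subset_of_add_subset_add_right {E : Type*} [TopologicalSpace E] [AddCommGroup E]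
    [Module ℝ E] [IsTopologicalAddGroup E] [ContinuousSMul ℝ E] [LocallyConvexSpace ℝ E]
    {s t u : Set E} (ht : Convex ℝ t) (ht_closed : IsClosed t) (hu : IsCompact u)
    (hu_nonempty : u.Nonempty) (h : s + u ⊆ t + u) : s ⊆ t := by
  intro x hx
  by_contra hxt
  obtain ⟨f, r, hf, hr⟩ := geometric_hahn_banach_closed_point ht ht_closed hxt
  obtain ⟨y, hy, hmax⟩ := hu.exists_isMaxOn hu_nonempty f.continuous.continuousOn
  obtain ⟨b, hb, z, hz, hsum⟩ := h (Set.add_mem_add hx hy)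
  have hfsum : f b + f z = f x + f y := by
    rw [← map_add, ← map_add]
    exact congrArg f hsum
  linarith [hf b hb, isMaxOn_iff.mp hmax z hz]

/-- Minkowski summation of polytopes is cancellative: if `A, B, C` are
nonempty finite subsets of `ℝ^d` and
`convexHull A + convexHull C = convexHull B + convexHull C`, then
`convexHull A = convexHull B`. -/
theorem minkowski_cancellative {d : ℕ} (A B C : Finset (Fin d → ℝ))
    (hA : A.Nonempty) (hB : B.Nonempty) (hC : C.Nonempty)
    (h : convexHull ℝ (A : Set (Fin d → ℝ)) + convexHull ℝ (C : Set (Fin d → ℝ))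
        = convexHull ℝ (B : Set (Fin d → ℝ)) + convexHull ℝ (C : Set (Fin d → ℝ))) :
    convexHull ℝ (A : Set (Fin d → ℝ)) = convexHull ℝ (B : Set (Fin d → ℝ)) := by
  have compact (S : Finset (Fin d → ℝ)) : IsCompact (convexHull ℝ (S : Set (Fin d → ℝ))) :=
    S.finite_toSet.isCompact_convexHull ℝ
  have cancel (S T : Finset (Fin d → ℝ)) :=
    (convex_convexHull ℝ (T : Set (Fin d → ℝ))).subset_of_add_subset_add_right
      (s := convexHull ℝ (S : Set (Fin d → ℝ))) (compact T).isClosed (compact C)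
      hC.to_set.convexHull
  exact (cancel A B h.subset).antisymm (cancel B A h.superset)
end

section
/- Let v₁, …, v_k ∈ ℝ^d and let φ : ℝ^d → ℝ be a linear functional. Consider the Minkowski sum P = S₁ + ⋯ + S_k of the segments S_i = convexHull{0, v_i}. Then the minimal face F_φ(P) = {p ∈ P ∣ φ(p) = min{φ(q) ∣ q ∈ P}} is a single point if and only if φ(v_i) ≠ 0 for every index i with v_i ≠ 0. -/
open Pointwise

section Zonotope

variable {ι E : Type*} [AddCommGroup E] [Module ℝ E]

theorem mem_sum_convexHull_zero_pair_iff [Fintype ι] (v : ι → E) (x : E) :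
    x ∈ ∑ i, convexHull ℝ ({0, v i} : Set E) ↔
      ∃ t : ι → ℝ, (∀ i, t i ∈ Set.Icc (0 : ℝ) 1) ∧ ∑ i, t i • v i = x := by
  rw [Set.mem_fintype_sum]
  constructor
  · rintro ⟨g, hg, rfl⟩
    have h : ∀ i, ∃ t ∈ Set.Icc (0 : ℝ) 1, t • v i = g i := fun i => by
      have hi := hg i
      rw [convexHull_pair, segment_eq_image] at hi
      simpa using hi
    choose t ht htg using h
    exact ⟨t, ht, Finset.sum_congr rfl fun i _ => htg i⟩
  · rintro ⟨t, ht, rfl⟩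
    refine ⟨fun i => t i • v i, fun i => ?_, rfl⟩
    rw [convexHull_pair, segment_eq_image]
    exact ⟨t i, ht i, by simp⟩

/-- Coefficients of a point of the zonotope at which `φ` is minimal. -/
noncomputable def zonotopeMinCoeff (v : ι → E) (φ : E →ₗ[ℝ] ℝ) (i : ι) : ℝ :=
  if φ (v i) < 0 then 1 else 0

theorem zonotopeMinCoeff_mem_Icc (v : ι → E) (φ : E →ₗ[ℝ] ℝ) (i : ι) :
    zonotopeMinCoeff v φ i ∈ Set.Icc (0 : ℝ) 1 := by
  unfold zonotopeMinCoeff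
  split_ifs <;> simp

theorem zonotopeMinCoeff_mul_le (v : ι → E) (φ : E →ₗ[ℝ] ℝ) (i : ι) {t : ℝ}
    (ht : t ∈ Set.Icc (0 : ℝ) 1) : zonotopeMinCoeff v φ i * φ (v i) ≤ t * φ (v i) := by
  unfold zonotopeMinCoeff
  split_ifs with h
  · nlinarith [ht.2]
  · nlinarith [ht.1]

/-- The minimal face of a zonotope, described by coefficients. -/
theorem mem_zonotope_minFace_iff [Fintype ι] (v : ι → E) (φ : E →ₗ[ℝ] ℝ) (x : E) :
    x ∈ {r ∈ ∑ i, convexHull ℝ ({0, v i} : Set E) |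
        ∀ q ∈ ∑ i, convexHull ℝ ({0, v i} : Set E), φ r ≤ φ q} ↔
      ∃ t : ι → ℝ, (∀ i, t i ∈ Set.Icc (0 : ℝ) 1) ∧
        (∀ i, t i * φ (v i) = zonotopeMinCoeff v φ i * φ (v i)) ∧ ∑ i, t i • v i = x := by
  simp only [Set.mem_ofPred_eq, mem_sum_convexHull_zero_pair_iff]
  constructor
  · rintro ⟨⟨t, ht, rfl⟩, hmin⟩
    refine ⟨t, ht, fun i => ?_, rfl⟩
    have hle := hmin _ ⟨_, zonotopeMinCoeff_mem_Icc v φ, rfl⟩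
    simp only [map_sum, map_smul, smul_eq_mul] at hle
    have hge : ∀ j ∈ Finset.univ, zonotopeMinCoeff v φ j * φ (v j) ≤ t j * φ (v j) :=
      fun j _ => zonotopeMinCoeff_mul_le v φ j (ht j)
    exact ((Finset.sum_eq_sum_iff_of_le hge).1
      (le_antisymm (Finset.sum_le_sum hge) hle) i (Finset.mem_univ i)).symm
  · rintro ⟨t, ht, hteq, rfl⟩
    refine ⟨⟨t, ht, rfl⟩, ?_⟩
    rintro _ ⟨s, hs, rfl⟩
    simp only [map_sum, map_smul, smul_eq_mul, hteq]
    exact Finset.sum_le_sum fun i _ => zonotopeMinCoeff_mul_le v φ i (hs i)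

end Zonotope

/-- Let `v₁, …, v_k ∈ ℝ^d`, let `φ : ℝ^d → ℝ` be a linear functional, and
let `P = S₁ + ⋯ + S_k` be the Minkowski sum of the segments `Sᵢ = convexHull {0, vᵢ}`.
Then the minimal face `F_φ(P) = {p ∈ P ∣ φ p = min φ(P)}` is a single point if and only if
`φ(vᵢ) ≠ 0` for every `i` with `vᵢ ≠ 0`. -/
theorem zonotope_minFace_singleton_iff {d k : ℕ} (v : Fin k → (Fin d → ℝ))
    (φ : (Fin d → ℝ) →ₗ[ℝ] ℝ) :
    (∃ p : Fin d → ℝ,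
        {r ∈ ∑ i : Fin k, convexHull ℝ ({0, v i} : Set (Fin d → ℝ)) |
          ∀ q ∈ ∑ i : Fin k, convexHull ℝ ({0, v i} : Set (Fin d → ℝ)), φ r ≤ φ q} = {p})
      ↔ ∀ i : Fin k, v i ≠ 0 → φ (v i) ≠ 0 := by
  constructor
  · rintro ⟨p, hp⟩ i hvi hφ
    have key : ∀ c ∈ Set.Icc (0 : ℝ) 1,
        ∑ j, Function.update (zonotopeMinCoeff v φ) i c j • v j = p := fun c hc => by
      rw [← Set.mem_singleton_iff, ← hp, mem_zonotope_minFace_iff]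
      refine ⟨_, fun j => ?_, fun j => ?_, rfl⟩ <;> rcases eq_or_ne j i with rfl | hj
      · simpa using hc
      · simpa [hj] using zonotopeMinCoeff_mem_Icc v φ j
      · simp [hφ]
      · simp [hj]
    have h := (key 1 (by simp)).trans (key 0 (by simp)).symm
    rw [← sub_eq_zero, ← Finset.sum_sub_distrib, Finset.sum_eq_single i] at h
    · exact hvi (by simpa using h)
    · intro j _ hj
      simp [hj]
    · simp
  · intro h
    refine ⟨∑ i, zonotopeMinCoeff v φ i • v i, ?_⟩
    ext x
    rw [mem_zonotope_minFace_iff, Set.mem_singleton_iff]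
    constructor
    · rintro ⟨t, -, hteq, rfl⟩
      refine Finset.sum_congr rfl fun i _ => ?_
      by_cases hvi : v i = 0
      · simp [hvi]
      · rw [mul_right_cancel₀ (h i hvi) (hteq i)]
    · rintro rfl
      exact ⟨_, zonotopeMinCoeff_mem_Icc v φ, fun _ => rfl, rfl⟩
end
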